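/- Let x ≥ 3 and t ≥ 2 be integers with (t,x) ≠ (2,3). Let v be an integer with v ≡ 1 or −1 (mod tx), tx ≤ ⌊v/2⌋, and v·(tx − t − x − 1) > t²x² + t²x + tx² + t + x + 1. Then every multiset of size v − 1 whose support is {1, x, tx} is realizable. In particular, if t ≥ 7 and x ≥ 7, then for every v with v ≡ 1 or −1 (mod tx) and tx ≤ ⌊v/2⌋, every multiset of size v − 1 with support {1, x, tx} is realizable. -/

import Mathlib

/-- The multiset of absolute differences of consecutive entries of a list of naturals. -/
def linDiffs (l : List ℕ) : Multiset ℕ :=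
  ↑(List.zipWith (fun a b => (a - b) + (b - a)) l l.tail)

/-- `l` is a linear realization of the multiset `L`: it lists `0, …, |L|`
(each exactly once) and its consecutive absolute differences form `L`. -/
def IsLinearRealization (L : Multiset ℕ) (l : List ℕ) : Prop :=
  l.Perm (List.range (Multiset.card L + 1)) ∧ linDiffs l = L

def HasLinearRealization (L : Multiset ℕ) : Prop :=
  ∃ l : List ℕ, IsLinearRealization L l

/-- A standard linear realization starts at `0`. -/
def HasStandardLinearRealization (L : Multiset ℕ) : Prop :=
  ∃ l : List ℕ, IsLinearRealization L l ∧ l.head? = some 0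

/-- A perfect linear realization starts at `0` and ends at `v - 1 = |L|`. -/
def HasPerfectLinearRealization (L : Multiset ℕ) : Prop :=
  ∃ l : List ℕ, IsLinearRealization L l ∧ l.head? = some 0 ∧
    l.getLast? = some (Multiset.card L)

/-- The multiset of cyclic edge-lengths `min(|gᵢ₊₁ - gᵢ|, v - |gᵢ₊₁ - gᵢ|)`
of consecutive entries of a list of naturals. -/
def cycDiffs (v : ℕ) (l : List ℕ) : Multiset ℕ :=
  ↑(List.zipWith (fun a b => min ((a - b) + (b - a)) (v - ((a - b) + (b - a)))) l l.tail)

/-- `L` is (cyclically) realizable in `K_v`: some Hamiltonian path on the vertex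
set `{0, …, v-1}` has `L` as its multiset of edge-lengths. -/
def IsRealizable (v : ℕ) (L : Multiset ℕ) : Prop :=
  ∃ l : List ℕ, l.Perm (List.range v) ∧ cycDiffs v l = L

/-- The multiset `{1^a, x^b, y^c}`. -/
def mset3 (a b c x y : ℕ) : Multiset ℕ :=
  Multiset.replicate a 1 + Multiset.replicate b x + Multiset.replicate c y

/-- With `b = q'x + r'`, `0 ≤ r' < x`: `ω(x,b) = x - 1` if `q' = 0`, `r' = 1`,
or at least one of `x`, `r'` is even; otherwise `ω(x,b) = x`. -/
def omegaBHR (x b : ℕ) : ℕ :=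
  if b / x = 0 ∨ b % x = 1 ∨ Even x ∨ Even (b % x) then x - 1 else x

/-- The reduced form `ĝ = min(g, v - g)`. -/
def reducedForm (v g : ℕ) : ℕ := min g (v - g)

/-- The function `f` of Theorem 3.7 (counterexample characterization refined). -/
def fBHR (u w : ℕ) : ℕ :=
  if Even u ∧ Even w then w - 1
  else if u = 3 ∨ (Even u ∧ ¬ Even w) then u + w - 2
  else u + w - 1

/-- A multiset `L` of size `v - 1` with elements in `{1, …, ⌊v/2⌋}` is admissible
if for every divisor `d` of `v` the number of elements of `L` divisible by `d`
is at most `v - d`. -/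
def IsAdmissible (v : ℕ) (L : Multiset ℕ) : Prop :=
  Multiset.card L = v - 1 ∧ (∀ z ∈ L, 1 ≤ z ∧ z ≤ v / 2) ∧
  ∀ d : ℕ, d ∣ v → Multiset.card (L.filter (fun z => d ∣ z)) ≤ v - d

theorem linDiffs_cons_cons (a b : ℕ) (l : List ℕ) :
    linDiffs (a :: b :: l) = ((a - b) + (b - a)) ::ₘ linDiffs (b :: l) := rfl

theorem linDiffs_append_cons (l : List ℕ) (p : ℕ) (r : List ℕ) :
    linDiffs (l ++ p :: r) = linDiffs (l ++ [p]) + linDiffs (p :: r) := by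
  induction l with
  | nil => simp [linDiffs]
  | cons a l ih =>
    cases l with
    | nil => simp [linDiffs]
    | cons b l =>
      simp only [List.cons_append, linDiffs_cons_cons] at ih ⊢
      rw [ih, Multiset.cons_add]

theorem linDiffs_append (l : List ℕ) (p s : ℕ) (r : List ℕ) :
    linDiffs ((l ++ [p]) ++ s :: r) =
      linDiffs (l ++ [p]) + (((p - s) + (s - p)) ::ₘ linDiffs (s :: r)) := by
  rw [List.append_assoc, List.singleton_append, linDiffs_append_cons, linDiffs_cons_cons]

theorem linDiffs_reverse (l : List ℕ) : linDiffs l.reverse = linDiffs l := by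
  induction l with
  | nil => rfl
  | cons a l ih =>
    cases l with
    | nil => rfl
    | cons b l =>
      rw [List.reverse_cons, List.reverse_cons, linDiffs_append, ← List.reverse_cons, ih,
        linDiffs_cons_cons, Nat.add_comm (b - a)]
      simp [linDiffs, ← Multiset.singleton_add, add_comm]

theorem linDiffs_map {f : ℕ → ℕ} {l : List ℕ}
    (hf : ∀ a ∈ l, ∀ b ∈ l, (f a - f b) + (f b - f a) = (a - b) + (b - a)) :
    linDiffs (l.map f) = linDiffs l := by
  induction l with
  | nil => rfl
  | cons a l ih =>
    cases l with
    | nil => rfl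
    | cons b l =>
      simp only [List.map_cons, linDiffs_cons_cons] at ih ⊢
      rw [hf a (by simp) b (by simp),
        ih fun c hc d hd => hf c (List.mem_cons_of_mem _ hc) d (List.mem_cons_of_mem _ hd)]

theorem card_linDiffs (l : List ℕ) : Multiset.card (linDiffs l) = l.length - 1 := by
  simp [linDiffs]

/-- There is a path from `s` to `e` through exactly the vertices satisfying `P` whose steps have
length `1` or `x`, with `n` steps designated as having length `1`. -/
def HasPath (x n : ℕ) (P : ℕ → Prop) (s e : ℕ) : Prop :=
  ∃ l : List ℕ, l.Nodup ∧ (∀ m, m ∈ l ↔ P m) ∧ l.head? = some s ∧ l.getLast? = some e ∧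
    ∃ k, linDiffs l = Multiset.replicate n 1 + Multiset.replicate k x

namespace HasPath

theorem congr {x n : ℕ} {P Q : ℕ → Prop} {s e : ℕ} (h : HasPath x n P s e)
    (hPQ : ∀ m, P m ↔ Q m) : HasPath x n Q s e := by
  obtain rfl : P = Q := funext fun m => propext (hPQ m)
  exact h

theorem symm {x n : ℕ} {P : ℕ → Prop} {s e : ℕ} (h : HasPath x n P s e) :
    HasPath x n P e s := by
  obtain ⟨l, hnd, hmem, hs, he, k, hk⟩ := h
  exact ⟨l.reverse, by simpa, by simpa, by simpa, by simpa, k, by rwa [linDiffs_reverse]⟩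

theorem append {x n n' : ℕ} {P Q : ℕ → Prop} {s e s' e' : ℕ} (h : HasPath x n P s e)
    (h' : HasPath x n' Q s' e') (hPQ : ∀ m, P m → ¬ Q m) (hstep : s' = e + 1 ∨ e = s' + 1) :
    HasPath x (n + n' + 1) (fun m => P m ∨ Q m) s e' := by
  obtain ⟨l, hnd, hmem, hs, he, k, hk⟩ := h
  obtain ⟨l', hnd', hmem', hs', he', k', hk'⟩ := h'
  refine ⟨l ++ l', ?_, ?_, ?_, ?_, k + k', ?_⟩
  · refine hnd.append hnd' fun m hm hm' => hPQ m ((hmem m).1 hm) ((hmem' m).1 hm')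
  · simp [hmem, hmem']
  · simp [hs]
  · simp [he']
  · obtain ⟨l, rfl⟩ := List.getLast?_eq_some_iff.1 he
    obtain ⟨l', rfl⟩ := List.head?_eq_some_iff.1 hs'
    have h1 : (e - s') + (s' - e) = 1 := by omega
    rw [linDiffs_append, hk, hk', h1, Multiset.replicate_add, Multiset.replicate_add,
      Multiset.replicate_add, Multiset.replicate_one, ← Multiset.singleton_add]
    abel

end HasPath

theorem hasPath_singleton (x s : ℕ) : HasPath x 0 (fun m => m = s) s s :=
  ⟨[s], by simp, by simp, by simp, by simp, 0, by simp [linDiffs]⟩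

theorem div_mod_eq_iff {x i j m : ℕ} (hi : i < x) :
    (m % x = i ∧ m / x = j) ↔ m = i + x * j := by
  constructor
  · rintro ⟨rfl, rfl⟩
    exact (Nat.mod_add_div m x).symm
  · rintro rfl
    exact ⟨by rw [Nat.add_mul_mod_self_left, Nat.mod_eq_of_lt hi],
      by rw [Nat.add_mul_div_left _ _ (by omega), Nat.div_eq_of_lt hi, zero_add]⟩

theorem hasPath_column {x i : ℕ} (hi : i < x) (h : ℕ) :
    HasPath x 0 (fun m => m % x = i ∧ m / x < h + 1) i (i + x * h) := by
  induction h with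
  | zero =>
    refine (hasPath_singleton x i).congr fun m => ?_
    have := div_mod_eq_iff (j := 0) (m := m) hi
    simp at this ⊢
    omega
  | succ h ih =>
    obtain ⟨l, hnd, hmem, hs, he, k, hk⟩ := ih
    have key := fun m => div_mod_eq_iff (j := h + 1) (m := m) hi
    refine ⟨l ++ [i + x * (h + 1)], ?_, ?_, ?_, ?_, k + 1, ?_⟩
    · refine hnd.append (by simp) fun m hm hm' => ?_
      have h1 := (hmem m).1 hm
      have h2 := (key m).2 (by simpa using hm')
      omega
    · intro m
      rw [List.mem_append, hmem, List.mem_singleton, ← key]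
      omega
    · simp [hs]
    · simp
    · obtain ⟨l, rfl⟩ := List.getLast?_eq_some_iff.1 he
      have h1 : (i + x * h - (i + x * (h + 1))) + (i + x * (h + 1) - (i + x * h)) = x := by
        rw [Nat.mul_succ]
        omega
      rw [linDiffs_append, hk, h1, Multiset.replicate_succ]
      simp [linDiffs, ← Multiset.singleton_add, add_comm]

/-- The top (`β = true`) or bottom (`β = false`) vertex of the residue class of `i` modulo `x`,
where the class consists of `h + 1` vertices. -/
def corner (x h i : ℕ) (β : Bool) : ℕ := i + bif β then x * h else 0

theorem hasPath_column_corner {x i : ℕ} (hi : i < x) (h : ℕ) (β : Bool) :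
    HasPath x 0 (fun m => m % x = i ∧ m / x < h + 1) (corner x h i β) (corner x h i (!β)) := by
  cases β
  · exact hasPath_column hi h
  · exact (hasPath_column hi h).symm

theorem hasPath_serpentine {x c n : ℕ} (hn : c + n < x) (h : ℕ) (β : Bool) :
    HasPath x n (fun m => c ≤ m % x ∧ m % x ≤ c + n ∧ m / x < h + 1)
      (corner x h c β) (corner x h (c + n) (β ^^ decide (Even n))) := by
  induction n with
  | zero =>
    have := (hasPath_column_corner hn h β).congr
      (Q := fun m => c ≤ m % x ∧ m % x ≤ c + 0 ∧ m / x < h + 1) (by intro m; omega)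
    simpa using this
  | succ n ih =>
    have h1 := ih (by omega)
    have h2 := hasPath_column_corner (i := c + (n + 1)) hn h (β ^^ decide (Even n))
    have h3 := h1.append h2 (by intro m; omega) (Or.inl (by simp [corner]; omega))
    have h4 : (β ^^ decide (Even (n + 1))) = !(β ^^ decide (Even n)) := by
      by_cases he : Even n <;> simp [Nat.even_add_one, he]
    rw [h4]
    exact h3.congr (by intro m; omega)

theorem hasPath_serpentine_rev {x c n : ℕ} (hn : c + n < x) (h : ℕ) (β : Bool) :
    HasPath x n (fun m => c ≤ m % x ∧ m % x ≤ c + n ∧ m / x < h + 1)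
      (corner x h (c + n) β) (corner x h c (β ^^ decide (Even n))) := by
  have := (hasPath_serpentine hn h (β ^^ decide (Even n))).symm
  simpa [Bool.xor_assoc] using this

theorem lt_mul_add_iff {x q r m : ℕ} (hr : r ≤ x) (hx : 0 < x) :
    m < q * x + r ↔ m / x < q ∨ (m / x = q ∧ m % x < r) := by
  have h1 := Nat.mod_add_div m x
  have h2 := Nat.mod_lt m hx
  rcases lt_trichotomy (m / x) q with h | h | h
  · have : x * (m / x + 1) ≤ x * q := Nat.mul_le_mul_left _ h
    rw [Nat.mul_succ] at this
    rw [Nat.mul_comm q]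
    omega
  · subst h
    rw [Nat.mul_comm (m / x)]
    omega
  · have : x * (q + 1) ≤ x * (m / x) := Nat.mul_le_mul_left _ h
    rw [Nat.mul_succ] at this
    rw [Nat.mul_comm q]
    omega

theorem exists_hasPath_of_even {x r : ℕ} (q : ℕ) (hr : r < x) (hev : Even r) :
    ∃ e, HasPath x (x - 1) (· < (q + 1) * x + r) 0 e := by
  have h2 := hasPath_serpentine (x := x) (c := r) (n := x - 1 - r) (by omega) q false
  rcases Nat.eq_zero_or_pos r with rfl | hpos
  · refine ⟨_, h2.congr fun m => ?_⟩
    rw [lt_mul_add_iff hr.le (by omega)]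
    have := Nat.mod_lt m (by omega : 0 < x)
    omega
  · have h1 := hasPath_serpentine (x := x) (c := 0) (n := r - 1) (by omega) (q + 1) false
    have hodd : ¬ Even (r - 1) := by grind
    have h3 := h1.append h2 (by intro m; omega) (Or.inl (by simp [corner, hodd]; omega))
    rw [show r - 1 + (x - 1 - r) + 1 = x - 1 by omega] at h3
    refine ⟨_, h3.congr fun m => ?_⟩
    rw [lt_mul_add_iff hr.le (by omega)]
    have := Nat.mod_lt m (by omega : 0 < x)
    omega

theorem hasPath_descending {x r : ℕ} (q : ℕ) (hr : r < x) (hpos : 0 < r) :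
    HasPath x (x - r) (fun m => (m % x = 0 ∧ m / x < q + 2) ∨ (r ≤ m % x ∧ m / x < q + 1)) 0
      (corner x q r (decide (Odd (x - 1 - r)))) := by
  have h1 := hasPath_column (x := x) (i := 0) (by omega) (q + 1)
  have h2 := hasPath_serpentine_rev (x := x) (c := r) (n := x - 1 - r) (by omega) q true
  have h3 := h1.append h2 (by intro m; omega)
    (Or.inr (by simp only [corner, cond_true, Nat.mul_succ]; omega))
  rw [show 0 + (x - 1 - r) + 1 = x - r by omega] at h3
  have h4 : (true ^^ decide (Even (x - 1 - r))) = decide (Odd (x - 1 - r)) := by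
    simp [← Nat.not_even_iff_odd]
  rw [h4] at h3
  refine h3.congr fun m => ?_
  have := Nat.mod_lt m (by omega : 0 < x)
  omega

theorem exists_hasPath_of_odd_sub {x r : ℕ} (q : ℕ) (hr : r < x) (hpos : 0 < r)
    (h : r = 1 ∨ Even (x - 1 - r)) :
    ∃ e, HasPath x (x - 1) (· < (q + 1) * x + r) 0 e := by
  have h1 := hasPath_descending q hr hpos
  by_cases hr1 : r = 1
  · subst hr1
    refine ⟨_, h1.congr fun m => ?_⟩
    rw [lt_mul_add_iff hr.le (by omega)]
    omega
  · have hev := h.resolve_left hr1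
    have h2 := hasPath_serpentine_rev (x := x) (c := 1) (n := r - 2) (by omega) (q + 1) false
    have h3 := h1.append h2 (by intro m; omega)
      (Or.inr (by simp [corner, ← Nat.not_even_iff_odd, hev]; omega))
    rw [show x - r + (r - 2) + 1 = x - 1 by omega] at h3
    refine ⟨_, h3.congr fun m => ?_⟩
    rw [lt_mul_add_iff hr.le (by omega)]
    omega

theorem exists_hasPath_of_odd_of_odd {x r : ℕ} (q : ℕ) (hr : r < x) (h3 : 3 ≤ r)
    (hr_odd : Odd r) (hx_odd : Odd x) :
    ∃ e, HasPath x x (· < (q + 1) * x + r + 1) 0 e := by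
  have hlt : r + 1 < x := by grind
  have hev : Even (x - 1 - (r + 1)) := by grind
  have hev' : Even (r - 3) := by grind
  have hdesc := hasPath_descending q hlt (by omega)
  have hserp := hasPath_serpentine_rev (x := x) (c := 3) (n := r - 3) (by omega) (q + 1) false
  have htop := hasPath_singleton x (2 + x * (q + 1))
  have hdown := (hasPath_column (x := x) (i := 1) (by omega) (q + 1)).symm
  have hup := hasPath_column (x := x) (i := 2) (by omega) q
  have hiff := fun m => div_mod_eq_iff (i := 2) (j := q + 1) (m := m) (by omega : 2 < x)
  have h1 := hdesc.append hserp (by intro m; omega)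
    (Or.inr (by simp [corner, ← Nat.not_even_iff_odd, hev]; omega))
  have h2 := h1.append htop (by intro m; rw [← hiff]; omega)
    (Or.inr (by simp [corner, hev']; omega))
  have h3 := h2.append hdown (by intro m; rw [← hiff]; omega) (Or.inr (by omega))
  have h4 := h3.append hup (by intro m; rw [← hiff]; omega) (Or.inl rfl)
  rw [show x - (r + 1) + (r - 3) + 1 + 0 + 1 + 0 + 1 + 0 + 1 = x by omega] at h4
  refine ⟨_, h4.congr fun m => ?_⟩
  rw [← hiff, add_assoc ((q + 1) * x), lt_mul_add_iff hlt.le (by omega)]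
  omega

theorem exists_hasPath {x : ℕ} (hx : 0 < x) (b : ℕ) :
    ∃ a ≤ x, ∃ e, HasPath x a (· < b + a + 1) 0 e := by
  have hr := Nat.mod_lt b hx
  have hb := Nat.mod_add_div b x
  set r := b % x
  set q := b / x
  have hN : (q + 1) * x + r = b + (x - 1) + 1 := by
    rw [add_mul, Nat.mul_comm q]
    omega
  by_cases hev : Even r
  · exact ⟨x - 1, by omega, hN ▸ exists_hasPath_of_even q hr hev⟩
  rw [Nat.not_even_iff_odd] at hev
  have hpos := hev.pos
  by_cases hD : r = 1 ∨ Even (x - 1 - r)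
  · exact ⟨x - 1, by omega, hN ▸ exists_hasPath_of_odd_sub q hr hpos hD⟩
  · have hx_odd : Odd x := by grind
    have := exists_hasPath_of_odd_of_odd q hr (by grind) hev hx_odd
    rw [hN] at this
    exact ⟨x, le_rfl, by simpa [show b + (x - 1) + 1 = b + x by omega] using this⟩

theorem HasStandardLinearRealization.one_cons {L : Multiset ℕ}
    (h : HasStandardLinearRealization L) : HasStandardLinearRealization (1 ::ₘ L) := by
  obtain ⟨l, ⟨hperm, hdiff⟩, hhead⟩ := h
  refine ⟨0 :: l.map Nat.succ, ⟨?_, ?_⟩, rfl⟩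
  · rw [Multiset.card_cons, List.range_succ_eq_map]
    exact (hperm.map _).cons _
  · have h1 : linDiffs (l.map Nat.succ) = L := by
      rw [linDiffs_map (by intro a _ b _; omega), hdiff]
    obtain ⟨l, rfl⟩ := List.head?_eq_some_iff.1 hhead
    rw [List.map_cons] at h1 ⊢
    rw [linDiffs_cons_cons, h1]

theorem hasStandardLinearRealization_one_x {x a : ℕ} (hx : 0 < x) (ha : x ≤ a) (b : ℕ) :
    HasStandardLinearRealization (Multiset.replicate a 1 + Multiset.replicate b x) := by
  obtain ⟨a', ha', e, l, hnd, hmem, hs, -, k, hk⟩ := exists_hasPath hx b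
  have hperm : l.Perm (List.range (b + a' + 1)) :=
    (List.perm_ext_iff_of_nodup hnd List.nodup_range).2 fun m => by simp [hmem]
  have hcard := card_linDiffs l
  have hlen := hperm.length_eq
  simp [hk] at hcard hlen
  obtain rfl : k = b := by omega
  obtain ⟨d, rfl⟩ := Nat.exists_eq_add_of_le (ha'.trans ha)
  clear ha hcard
  induction d with
  | zero =>
    refine ⟨l, ⟨?_, hk⟩, hs⟩
    simpa [add_comm] using hperm
  | succ d ih => simpa [← add_assoc, Multiset.replicate_succ] using ih.one_cons

theorem HasStandardLinearRealization.add {L M : Multiset ℕ}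
    (hL : HasStandardLinearRealization L) (hM : HasStandardLinearRealization M) :
    HasLinearRealization (L + M) := by
  obtain ⟨l, ⟨hperm, hdiff⟩, hhead⟩ := hL
  obtain ⟨m, ⟨hperm', hdiff'⟩, hhead'⟩ := hM
  obtain ⟨l, rfl⟩ := List.head?_eq_some_iff.1 hhead
  obtain ⟨m, rfl⟩ := List.head?_eq_some_iff.1 hhead'
  set n := Multiset.card L
  have hle : ∀ i ∈ 0 :: l, i ≤ n := fun i hi => by
    have := hperm.mem_iff.1 hi
    rw [List.mem_range] at this
    omega
  have h1 : linDiffs ((0 :: l).map (n - ·)).reverse = L := by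
    rw [linDiffs_reverse, linDiffs_map, hdiff]
    intro a ha b hb
    have := hle a ha
    have := hle b hb
    omega
  have h2 : linDiffs ((0 :: m).map (n + ·)) = M := by
    rw [linDiffs_map (by intro a _ b _; omega), hdiff']
  refine ⟨((0 :: l).map (n - ·)).reverse ++ m.map (n + ·), ?_, ?_⟩
  · have hr : List.range (Multiset.card M + 1) = 0 :: (List.range (Multiset.card M)).map Nat.succ :=
      List.range_succ_eq_map
    rw [hr, List.perm_cons] at hperm'
    have hp1 : ((0 :: l).map (n - ·)).reverse.Perm (List.range (n + 1)) := by
      refine (List.reverse_perm _).trans ((hperm.map _).trans ?_)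
      refine (List.perm_ext_iff_of_nodup ?_ List.nodup_range).2 fun i => ?_
      · refine List.Nodup.map_on ?_ List.nodup_range
        intro a ha b hb hab
        simp only [List.mem_range] at ha hb
        omega
      · simp only [List.mem_map, List.mem_range]
        exact ⟨fun ⟨j, hj, hij⟩ => by omega, fun hi => ⟨n - i, by omega, by omega⟩⟩
    have hp2 : (m.map (n + ·)).Perm ((List.range (Multiset.card M)).map ((n + 1) + ·)) := by
      refine (hperm'.map _).trans (List.Perm.of_eq ?_)
      rw [List.map_map]
      refine List.map_congr_left fun i _ => ?_
      simp only [Function.comp]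
      omega
    refine (hp1.append hp2).trans (List.Perm.of_eq ?_)
    rw [Multiset.card_add, show n + Multiset.card M + 1 = (n + 1) + Multiset.card M by omega,
      List.range_add (n := n + 1)]
  · rw [List.map_cons, List.reverse_cons] at h1 ⊢
    rw [List.map_cons] at h2
    rw [List.append_assoc, List.singleton_append, linDiffs_append_cons, h1]
    simpa using h2

theorem hasLinearRealization_mset3 {a x y : ℕ} (b c : ℕ) (hx : 0 < x) (hy : 0 < y)
    (ha : x + y ≤ a) : HasLinearRealization (mset3 a b c x y) := by
  obtain ⟨d, rfl⟩ := Nat.exists_eq_add_of_le ha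
  have h := (hasStandardLinearRealization_one_x hx (Nat.le_add_right x d) b).add
    (hasStandardLinearRealization_one_x hy le_rfl c)
  convert h using 1
  rw [mset3, show x + y + d = (x + d) + y by omega, Multiset.replicate_add (x + d)]
  abel

theorem isRealizable_map_of_coprime {v u : ℕ} {L : Multiset ℕ} (hL : HasLinearRealization L)
    (hcard : Multiset.card L + 1 = v) (huv : Nat.Coprime u v) :
    IsRealizable v (L.map fun d => reducedForm v (u * d % v)) := by
  obtain ⟨l, hperm, hdiff⟩ := hL
  rw [hcard] at hperm
  have hv : 0 < v := by omega
  refine ⟨l.map fun i => u * i % v, ?_, ?_⟩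
  · have hnd : ((List.range v).map fun i => u * i % v).Nodup := by
      refine List.Nodup.map_on ?_ List.nodup_range
      intro i hi j hj hij
      rw [List.mem_range] at hi hj
      have : i ≡ j [MOD v] := Nat.ModEq.cancel_left_of_coprime (by rwa [Nat.gcd_comm]) hij
      rwa [Nat.ModEq, Nat.mod_eq_of_lt hi, Nat.mod_eq_of_lt hj] at this
    refine (hperm.map _).trans ((List.subperm_of_subset hnd ?_).perm_of_length_le (by simp))
    intro i hi
    obtain ⟨j, -, rfl⟩ := List.mem_map.1 hi
    exact List.mem_range.2 (Nat.mod_lt _ hv)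
  · rw [← hdiff, cycDiffs, linDiffs, Multiset.map_coe, ← List.map_tail, List.zipWith_map,
      List.map_zipWith]
    congr 2
    funext i j
    wlog hij : j ≤ i generalizing i j
    · have := this j i (by omega)
      rwa [Nat.add_comm, Nat.add_comm (j - i)] at this
    obtain ⟨d, rfl⟩ := Nat.exists_eq_add_of_le hij
    have hd : j + d - j + (j - (j + d)) = d := by omega
    simp only [hd, reducedForm, Nat.mul_add]
    have h1 := Nat.mod_lt (u * j) hv
    have h2 := Nat.mod_lt (u * d) hv
    rw [Nat.add_mod (u * j)]
    generalize u * j % v = p at *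
    generalize u * d % v = w at *
    rcases lt_or_ge (p + w) v with h | h
    · rw [Nat.mod_eq_of_lt h]
      omega
    · rw [Nat.mod_eq_sub_mod h, Nat.mod_eq_of_lt (by omega)]
      omega

theorem map_mset3 (f : ℕ → ℕ) (a b c x y : ℕ) :
    (mset3 a b c x y).map f =
      Multiset.replicate a (f 1) + Multiset.replicate b (f x) + Multiset.replicate c (f y) := by
  simp [mset3]

theorem reducedForm_of_le {v z : ℕ} (hz : z ≤ v / 2) (hpos : 0 < z) :
    reducedForm v (z % v) = z := by
  rw [Nat.mod_eq_of_lt (by omega), reducedForm]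
  omega

theorem reducedForm_mul_of_near {v w z : ℕ} (hw : v = w + 1 ∨ w = v + 1) (hz : z ≤ v / 2)
    (hpos : 0 < z) : reducedForm v (w * z % v) = z := by
  rcases hw with rfl | rfl
  · have h : w * z = (w + 1 - z) + (w + 1) * (z - 1) := by
      obtain ⟨z, rfl⟩ := Nat.exists_eq_add_of_lt hpos
      obtain ⟨d, rfl⟩ := Nat.exists_eq_add_of_le (show z + 1 ≤ w by omega)
      simp only [zero_add, Nat.add_sub_cancel]
      rw [show z + 1 + d + 1 - (z + 1) = d + 1 by omega]
      ring
    rw [h, Nat.add_mul_mod_self_left, Nat.mod_eq_of_lt (by omega), reducedForm]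
    omega
  · rw [show (v + 1) * z = z + v * z by ring, Nat.add_mul_mod_self_left,
      reducedForm_of_le hz hpos]

theorem isRealizable_mset3 {t x v k a b c : ℕ} (hx : 0 < x) (ht : 0 < t) (hk : 0 < k)
    (hv : v = k * (t * x) + 1 ∨ k * (t * x) = v + 1) (hle : t * x ≤ v / 2)
    (hcard : a + b + c + 1 = v)
    (h : x + t * x ≤ a ∨ t + k * t ≤ b ∨ k + k * x ≤ c) :
    IsRealizable v (mset3 a b c x (t * x)) := by
  have htx : 0 < t * x := Nat.mul_pos ht hx
  have hx_le : x ≤ v / 2 := (Nat.le_mul_of_pos_left x ht).trans hle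
  have hcop : Nat.Coprime (t * x) v := by
    have hd : Nat.gcd (t * x) v ∣ k * (t * x) := (Nat.gcd_dvd_left _ _).mul_left _
    have hd' := Nat.gcd_dvd_right (t * x) v
    refine Nat.dvd_one.1 ?_
    rcases hv with hv | hv
    · exact (Nat.dvd_add_right hd).1 (hv ▸ hd')
    · exact (Nat.dvd_add_right hd').1 (hv ▸ hd)
  have hone : 1 ≤ v / 2 := by omega
  have f_x := reducedForm_of_le hx_le hx
  have f_tx := reducedForm_of_le hle htx
  have f_one := reducedForm_mul_of_near hv hone one_pos
  have f_x' := reducedForm_mul_of_near hv hx_le hx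
  rw [mul_one] at f_one
  have hmset : ∀ p q r y z, Multiset.card (mset3 p q r y z) = p + q + r := by simp [mset3]
  rcases h with h | h | h
  · have key := isRealizable_map_of_coprime (u := 1) (hasLinearRealization_mset3 b c hx htx h)
      (by rw [hmset, hcard]) (Nat.coprime_one_left v)
    rw [map_mset3] at key
    simpa only [one_mul, f_x, f_tx, reducedForm_of_le hone one_pos, mset3] using key
  · have key := isRealizable_map_of_coprime (u := x)
      (hasLinearRealization_mset3 c a ht (Nat.mul_pos hk ht) h)
      (by rw [hmset]; omega) (hcop.coprime_dvd_left (Nat.dvd_mul_left x t))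
    rw [map_mset3, mul_one, f_x, mul_comm x t, f_tx,
      show x * (k * t) = k * (t * x) by ring, f_one] at key
    convert key using 1
    rw [mset3]
    abel
  · have key := isRealizable_map_of_coprime (u := t * x)
      (hasLinearRealization_mset3 a b hk (Nat.mul_pos hk hx) h)
      (by rw [hmset]; omega) hcop
    rw [map_mset3, mul_one, f_tx, mul_comm (t * x) k, f_one,
      show t * x * (k * x) = k * (t * x) * x by ring, f_x'] at key
    convert key using 1
    rw [mset3]
    abel

theorem exists_eq_mset3 {x y : ℕ} {L : Multiset ℕ} (hx : 1 < x) (hxy : x < y)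
    (hL : L.toFinset = {1, x, y}) : ∃ a b c, L = mset3 a b c x y := by
  refine ⟨L.count 1, L.count x, L.count y, ?_⟩
  ext d
  have hd : d ∈ L ↔ d = 1 ∨ d = x ∨ d = y := by simp [← Multiset.mem_toFinset, hL]
  simp only [mset3, Multiset.count_add, Multiset.count_replicate]
  by_cases h : d ∈ L
  · rcases hd.1 h with rfl | rfl | rfl
    · simp [hx.ne', (hx.trans hxy).ne']
    · simp [hx.ne, hxy.ne']
    · simp [hxy.ne, (hx.trans hxy).ne]
  · rw [Multiset.count_eq_zero_of_notMem h]
    rw [hd] at h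
    push Not at h
    simp [h.1.symm, h.2.1.symm, h.2.2.symm]

theorem many_ones_of_large {t x v k a b c : ℕ}
    (hv : v = k * (t * x) + 1 ∨ k * (t * x) = v + 1) (hcard : a + b + c + 1 = v)
    (hbig : t ^ 2 * x ^ 2 + t ^ 2 * x + t * x ^ 2 + t + x + 1 < v * (t * x - t - x - 1)) :
    x + t * x ≤ a ∨ t + k * t ≤ b ∨ k + k * x ≤ c := by
  by_contra! hlt
  obtain ⟨ha, hb, hc⟩ := hlt
  have hW : 0 < t * x - t - x - 1 := Nat.pos_of_ne_zero fun h0 => by simp [h0] at hbig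
  obtain ⟨W, hW⟩ : ∃ W, t * x = W + t + x + 1 := ⟨t * x - t - x - 1, by omega⟩
  rw [show t * x - t - x - 1 = W by omega,
    show t ^ 2 * x ^ 2 + t ^ 2 * x + t * x ^ 2 = (t * x) * (t * x + t + x) by ring] at hbig
  have hkW : k * (t * x) = k * W + k * t + k * x + k := by
    rw [hW]
    ring
  generalize t * x = T at *
  have hS : k * W + 1 ≤ T + t + x := by omega
  have hTS : T * (k * W + 1) ≤ T * (T + t + x) := Nat.mul_le_mul_left _ hS
  have hvW : v * W ≤ k * T * W + W := by
    rw [← Nat.succ_mul]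
    exact Nat.mul_le_mul_right _ (by omega)
  have : T * (k * W + 1) = k * T * W + T := by ring
  omega

theorem isRealizable_of_large {t x v : ℕ} (hx : 3 ≤ x) (ht : 2 ≤ t)
    (hv : v % (t * x) = 1 ∨ v % (t * x) = t * x - 1) (hle : t * x ≤ v / 2)
    (hbig : t ^ 2 * x ^ 2 + t ^ 2 * x + t * x ^ 2 + t + x + 1 < v * (t * x - t - x - 1))
    {L : Multiset ℕ} (hcard : Multiset.card L = v - 1) (hL : L.toFinset = {1, x, t * x}) :
    IsRealizable v L := by
  have hxt : x < t * x := by nlinarith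
  obtain ⟨a, b, c, rfl⟩ := exists_eq_mset3 (by omega) hxt hL
  have hsum : a + b + c + 1 = v := by
    simp [mset3] at hcard
    omega
  obtain ⟨k, hk, hkv⟩ : ∃ k, 0 < k ∧ (v = k * (t * x) + 1 ∨ k * (t * x) = v + 1) := by
    have hdiv := Nat.div_add_mod v (t * x)
    rw [mul_comm] at hdiv
    rcases hv with hv | hv
    · exact ⟨v / (t * x), Nat.div_pos (by omega) (by omega), Or.inl (by omega)⟩
    · refine ⟨v / (t * x) + 1, Nat.succ_pos _, Or.inr ?_⟩
      rw [Nat.succ_mul]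
      omega
  exact isRealizable_mset3 (by omega) (by omega) hk hkv hle hsum
    (many_ones_of_large hkv hsum hbig)

theorem large_of_seven_le {t x v : ℕ} (ht : 7 ≤ t) (hx : 7 ≤ x) (hle : t * x ≤ v / 2) :
    t ^ 2 * x ^ 2 + t ^ 2 * x + t * x ^ 2 + t + x + 1 < v * (t * x - t - x - 1) := by
  have hT : 3 * t + 3 * x + 7 ≤ t * x := by
    obtain ⟨t, rfl⟩ := Nat.exists_eq_add_of_le ht
    obtain ⟨x, rfl⟩ := Nat.exists_eq_add_of_le hx
    nlinarith
  obtain ⟨W, hW⟩ : ∃ W, t * x = W + t + x + 1 := ⟨t * x - t - x - 1, by omega⟩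
  have h1 : 2 * (t * x) * W ≤ v * W := Nat.mul_le_mul_right _ (by omega)
  have h2 : (t * x) * (t * x + t + x + 1) ≤ (t * x) * (2 * W) :=
    Nat.mul_le_mul_left _ (by omega)
  rw [show t * x - t - x - 1 = W by omega,
    show t ^ 2 * x ^ 2 + t ^ 2 * x + t * x ^ 2 = (t * x) * (t * x + t + x) by ring]
  have h3 : (t * x) * (t * x + t + x + 1) = (t * x) * (t * x + t + x) + t * x := by ring
  have h4 : (t * x) * (2 * W) = 2 * (t * x) * W := by ring
  omega

/-- Let `x ≥ 3`, `t ≥ 2`, `(t, x) ≠ (2, 3)`. If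
`v ≡ ±1 (mod tx)`, `tx ≤ ⌊v/2⌋` and
`v(tx - t - x - 1) > t²x² + t²x + tx² + t + x + 1`, then every multiset of size
`v - 1` with support `{1, x, tx}` is realizable. In particular this holds
whenever `t, x ≥ 7` (without the largeness condition on `v`). -/
theorem stmt15 :
    (∀ t x v : ℕ, 3 ≤ x → 2 ≤ t → ¬(t = 2 ∧ x = 3) →
      (v % (t * x) = 1 ∨ v % (t * x) = t * x - 1) → t * x ≤ v / 2 →
      t ^ 2 * x ^ 2 + t ^ 2 * x + t * x ^ 2 + t + x + 1 <
        v * (t * x - t - x - 1) →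
      ∀ L : Multiset ℕ, Multiset.card L = v - 1 →
        L.toFinset = {1, x, t * x} → IsRealizable v L) ∧
    (∀ t x v : ℕ, 7 ≤ t → 7 ≤ x →
      (v % (t * x) = 1 ∨ v % (t * x) = t * x - 1) → t * x ≤ v / 2 →
      ∀ L : Multiset ℕ, Multiset.card L = v - 1 →
        L.toFinset = {1, x, t * x} → IsRealizable v L) := by
  exact ⟨fun _ _ _ hx ht _ hv hle hbig _ hcard hL =>
      isRealizable_of_large hx ht hv hle hbig hcard hL,
    fun _ _ _ ht hx hv hle _ hcard hL =>
      isRealizable_of_large (by omega) (by omega) hv hle (large_of_seven_le ht hx hle) hcard hL⟩
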